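/- For any constant C > 0, the limit as p → ∞ of τ(C p^{1/2}, p) equals 1 − √(π/2) · (e^{1/(2C²)}/C) · erfc(1/(√2 C)), where erfc is the complementary error function; moreover this limiting expression is strictly increasing in C, and the equation 1 − √(π/2) (e^{1/(2C²)}/C) erfc(1/(√2 C)) = 1/2 has a unique positive solution C ≈ 1.634. -/

import Mathlib

open MeasureTheory Filter Real

noncomputable def tau (l : ℝ) (p : ℕ) : ℝ :=
  l ^ 2 / 2 * ∫ x in Set.Ioi (0 : ℝ),
    (1 + l ^ 2 * x) ^ (-(3 : ℝ) / 2) * (1 + x) ^ ((1 - (p : ℝ)) / 2)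

noncomputable def erfc (z : ℝ) : ℝ :=
  2 / Real.sqrt π * ∫ v in Set.Ioi z, Real.exp (-v ^ 2)

noncomputable def limitExpr (C : ℝ) : ℝ :=
  1 - Real.sqrt (π / 2) * (Real.exp (1 / (2 * C ^ 2)) / C) * erfc (1 / (Real.sqrt 2 * C))

noncomputable def II (z : ℝ) : ℝ := ∫ v in Set.Ioi z, Real.exp (-v ^ 2)

noncomputable def GG (z : ℝ) : ℝ := 1 - 2 * z * Real.exp (z ^ 2) * II z

lemma int_gauss : Integrable (fun v : ℝ => Real.exp (-v ^ 2)) := by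
  simpa using integrable_exp_neg_mul_sq (b := 1) one_pos

lemma cont_gauss : Continuous (fun v : ℝ => Real.exp (-v ^ 2)) := by fun_prop

lemma II_eq (z : ℝ) : II z = Real.sqrt π / 2 - ∫ v in (0 : ℝ)..z, Real.exp (-v ^ 2) := by
  have h := intervalIntegral.integral_interval_add_Ioi (a := 0) (b := z)
    int_gauss.integrableOn int_gauss.integrableOn
  have h2 := integral_gaussian_Ioi 1
  simp only [div_one, neg_mul, one_mul] at h2
  rw [h2] at h
  unfold II
  linarith

lemma II_deriv (z : ℝ) : HasDerivAt II (-Real.exp (-z ^ 2)) z := by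
  have h := (cont_gauss.integral_hasStrictDerivAt 0 z).hasDerivAt.const_sub (Real.sqrt π / 2)
  have e : II = fun z => Real.sqrt π / 2 - ∫ v in (0 : ℝ)..z, Real.exp (-v ^ 2) := funext II_eq
  rw [e]; exact h

lemma II_cont : Continuous II :=
  continuous_iff_continuousAt.2 fun z => (II_deriv z).continuousAt

lemma II_tendsto : Tendsto II atTop (nhds 0) := by
  have e : II = fun z => Real.sqrt π / 2 - ∫ v in (0 : ℝ)..z, Real.exp (-v ^ 2) := funext II_eq
  have h := intervalIntegral_tendsto_integral_Ioi 0 (int_gauss.integrableOn) tendsto_id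
  have h2 := integral_gaussian_Ioi 1
  simp only [div_one, neg_mul, one_mul] at h2
  rw [h2] at h
  rw [e]
  simpa using h.const_sub (Real.sqrt π / 2)

lemma GG_cont : Continuous GG := by
  have := II_cont
  unfold GG; fun_prop

lemma rpow_form {y : ℝ} (hy : 0 < y) : y ^ (-(3 : ℝ) / 2) = 1 / (y * Real.sqrt y) := by
  rw [show -(3 : ℝ) / 2 = -(1 + 1 / 2) by norm_num, Real.rpow_neg hy.le, Real.rpow_add hy,
    Real.rpow_one, ← Real.sqrt_eq_rpow, one_div]

noncomputable def FF (z u : ℝ) : ℝ :=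
  -(Real.sqrt (1 + u))⁻¹ * Real.exp (-u * z ^ 2) + 2 * z * Real.exp (z ^ 2) * II (z * Real.sqrt (1 + u))

lemma FF_deriv (z u : ℝ) (hu : 0 ≤ u) :
    HasDerivAt (FF z) (1 / 2 * ((1 + u) ^ (-(3 : ℝ) / 2) * Real.exp (-u * z ^ 2))) u := by
  have hy : 0 < 1 + u := by linarith
  have hs : HasDerivAt (fun u : ℝ => Real.sqrt (1 + u)) (1 / (2 * Real.sqrt (1 + u))) u :=
    ((hasDerivAt_id u).const_add 1).sqrt hy.ne'
  have hsp : 0 < Real.sqrt (1 + u) := Real.sqrt_pos.2 hy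
  have he : HasDerivAt (fun u : ℝ => Real.exp (-u * z ^ 2))
      (Real.exp (-u * z ^ 2) * (-1 * z ^ 2)) u :=
    (((hasDerivAt_id u).neg).mul_const (z ^ 2)).exp
  have hI : HasDerivAt (fun u : ℝ => II (z * Real.sqrt (1 + u)))
      (-Real.exp (-(z * Real.sqrt (1 + u)) ^ 2) * (z * (1 / (2 * Real.sqrt (1 + u))))) u :=
    (II_deriv _).comp u (hs.const_mul z)
  have h := ((hs.inv hsp.ne').neg.mul he).add (hI.const_mul (2 * z * Real.exp (z ^ 2)))
  refine h.congr_deriv ?_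
  rw [rpow_form hy]
  have e1 : Real.exp (-(z * Real.sqrt (1 + u)) ^ 2) = Real.exp (-u * z ^ 2) * (Real.exp (z ^ 2))⁻¹ := by
    rw [← Real.exp_neg, ← Real.exp_add, mul_pow, Real.sq_sqrt hy.le]; ring_nf
  rw [e1]
  have hE := Real.exp_pos (z ^ 2)
  have hq : Real.sqrt (1 + u) ^ 2 = 1 + u := Real.sq_sqrt hy.le
  simp only [Pi.neg_apply, Pi.inv_apply]
  rw [← hq]
  simp only [Real.sqrt_sq hsp.le]
  field_simp
  ring

lemma sqrt_tendsto : Tendsto (fun u : ℝ => Real.sqrt (1 + u)) atTop atTop :=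
  Real.tendsto_sqrt_atTop.comp (tendsto_atTop_add_const_left _ 1 tendsto_id)

lemma FF_tendsto {z : ℝ} (hz : 0 < z) : Tendsto (FF z) atTop (nhds 0) := by
  have h1 : Tendsto (fun u : ℝ => Real.exp (-u * z ^ 2)) atTop (nhds 0) := by
    apply Real.tendsto_exp_atBot.comp
    exact tendsto_neg_atTop_atBot.atBot_mul_const (by positivity)
  have h2 := (tendsto_inv_atTop_zero.comp sqrt_tendsto).neg.mul h1
  have h3 := (II_tendsto.comp (sqrt_tendsto.const_mul_atTop hz)).const_mul
    (2 * z * Real.exp (z ^ 2))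
  have := h2.add h3
  change Tendsto (fun u => FF z u) atTop (nhds 0)
  simpa [FF] using this

lemma kern_nonneg (z u : ℝ) (hu : 0 < u) :
    0 < (1 + u) ^ (-(3 : ℝ) / 2) * Real.exp (-u * z ^ 2) := by
  have : 0 < 1 + u := by linarith
  positivity

lemma kern_int {z : ℝ} (hz : 0 < z) : IntegrableOn
    (fun u : ℝ => 1 / 2 * ((1 + u) ^ (-(3 : ℝ) / 2) * Real.exp (-u * z ^ 2))) (Set.Ioi 0) :=
  integrableOn_Ioi_deriv_of_nonneg (FF_deriv z 0 le_rfl).continuousAt.continuousWithinAt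
    (fun u hu => FF_deriv z u (le_of_lt hu))
    (fun u hu => by have := kern_nonneg z u hu; linarith) (FF_tendsto hz)

lemma GG_eq {z : ℝ} (hz : 0 < z) :
    ∫ u in Set.Ioi (0 : ℝ), 1 / 2 * ((1 + u) ^ (-(3 : ℝ) / 2) * Real.exp (-u * z ^ 2)) = GG z := by
  rw [integral_Ioi_of_hasDerivAt_of_nonneg' (fun u hu => FF_deriv z u hu)
    (fun u hu => by have := kern_nonneg z u hu; linarith) (FF_tendsto hz)]
  simp [FF, GG]
  ring

lemma GG_anti {z w : ℝ} (hz : 0 < z) (hzw : z < w) : GG w < GG z := by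
  have hw := hz.trans hzw
  rw [← GG_eq hz, ← GG_eq hw, ← sub_pos, ← integral_sub (kern_int hz) (kern_int hw)]
  have key : ∀ u ∈ Set.Ioi (0 : ℝ),
      0 < 1 / 2 * ((1 + u) ^ (-(3 : ℝ) / 2) * Real.exp (-u * z ^ 2)) -
        1 / 2 * ((1 + u) ^ (-(3 : ℝ) / 2) * Real.exp (-u * w ^ 2)) := by
    intro u hu
    have hu : 0 < u := hu
    have h1 : 0 < (1 + u) ^ (-(3 : ℝ) / 2) := Real.rpow_pos_of_pos (by linarith) _
    have h2 : Real.exp (-u * w ^ 2) < Real.exp (-u * z ^ 2) := by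
      apply Real.exp_lt_exp.2
      have : z ^ 2 < w ^ 2 := by gcongr
      nlinarith
    nlinarith [mul_lt_mul_of_pos_left h2 h1]
  rw [setIntegral_pos_iff_support_of_nonneg_ae]
  · have : Set.Ioi (0 : ℝ) ⊆ Function.support (fun u : ℝ =>
        1 / 2 * ((1 + u) ^ (-(3 : ℝ) / 2) * Real.exp (-u * z ^ 2)) -
        1 / 2 * ((1 + u) ^ (-(3 : ℝ) / 2) * Real.exp (-u * w ^ 2))) :=
      fun u hu => (key u hu).ne'
    rw [Set.inter_eq_right.2 this]
    simp
  · filter_upwards [ae_restrict_mem measurableSet_Ioi] with u hu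
    exact (key u hu).le
  · exact (kern_int hz).sub (kern_int hw)

lemma limitExpr_eq {C : ℝ} (hC : 0 < C) : limitExpr C = GG (1 / (Real.sqrt 2 * C)) := by
  unfold limitExpr GG erfc
  change 1 - Real.sqrt (π / 2) * (Real.exp (1 / (2 * C ^ 2)) / C) *
    (2 / Real.sqrt π * II (1 / (Real.sqrt 2 * C))) = _
  have h2 : Real.sqrt 2 ^ 2 = 2 := Real.sq_sqrt (by norm_num)
  have h2p : 0 < Real.sqrt 2 := by positivity
  have hp : 0 < Real.sqrt π := Real.sqrt_pos.2 Real.pi_pos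
  have e : (1 / (Real.sqrt 2 * C)) ^ 2 = 1 / (2 * C ^ 2) := by
    rw [div_pow, mul_pow, h2, one_pow]
  rw [e, Real.sqrt_div Real.pi_pos.le]
  field_simp

lemma strictMono : StrictMonoOn limitExpr (Set.Ioi 0) := by
  intro a ha b hb hab
  have ha : 0 < a := ha
  have hb : 0 < b := hb
  rw [limitExpr_eq ha, limitExpr_eq hb]
  apply GG_anti (by positivity)
  gcongr

lemma gauss_approx {v : ℝ} (hv : 0 ≤ v) (hv1 : v ≤ 1) :
    |Real.exp (-v ^ 2) - (1 - v ^ 2 + v ^ 4 / 2 - v ^ 6 / 6 + v ^ 8 / 24)| ≤ v ^ 10 / 100 := by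
  have h := Real.exp_bound (x := -v ^ 2) (by rw [abs_neg, abs_of_nonneg (by positivity)]; nlinarith)
    (n := 5) (by norm_num)
  rw [abs_neg, abs_of_nonneg (by positivity : 0 ≤ v ^ 2)] at h
  simp only [Finset.sum_range_succ, Finset.sum_range_zero, Nat.factorial] at h
  norm_num at h
  convert h using 2 <;> ring

lemma II_lower {z : ℝ} (hz : 0 ≤ z) (hz1 : z ≤ 1) : ∫ v in (0 : ℝ)..z, Real.exp (-v ^ 2) ≤
    z - z ^ 3 / 3 + z ^ 5 / 10 - z ^ 7 / 42 + z ^ 9 / 216 + z ^ 11 / 1100 := by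
  have h : ∫ v in (0 : ℝ)..z, Real.exp (-v ^ 2) ≤ ∫ v in (0 : ℝ)..z,
      (1 - v ^ 2 + v ^ 4 / 2 - v ^ 6 / 6 + v ^ 8 / 24 + v ^ 10 / 100) := by
    apply intervalIntegral.integral_mono_on hz (cont_gauss.intervalIntegrable _ _)
      (Continuous.intervalIntegrable (by fun_prop) _ _)
    intro v hv
    have := abs_le.1 (gauss_approx hv.1 (hv.2.trans hz1))
    linarith
  refine h.trans (le_of_eq ?_)
  rw [intervalIntegral.integral_eq_sub_of_hasDerivAt (f := fun z : ℝ =>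
    z - z ^ 3 / 3 + z ^ 5 / 10 - z ^ 7 / 42 + z ^ 9 / 216 + z ^ 11 / 1100) ?_
    (Continuous.intervalIntegrable (by fun_prop) _ _)]
  · norm_num
  · intro v _
    refine HasDerivAt.congr_deriv ((((((hasDerivAt_id v).sub ((hasDerivAt_pow 3 v).div_const 3)).add
      ((hasDerivAt_pow 5 v).div_const 10)).sub ((hasDerivAt_pow 7 v).div_const 42)).add
      ((hasDerivAt_pow 9 v).div_const 216)).add ((hasDerivAt_pow 11 v).div_const 1100)) ?_
    norm_num
    ring

lemma II_upper {z : ℝ} (hz : 0 ≤ z) (hz1 : z ≤ 1) :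
    z - z ^ 3 / 3 + z ^ 5 / 10 - z ^ 7 / 42 + z ^ 9 / 216 - z ^ 11 / 1100 ≤
    ∫ v in (0 : ℝ)..z, Real.exp (-v ^ 2) := by
  have h : ∫ v in (0 : ℝ)..z,
      (1 - v ^ 2 + v ^ 4 / 2 - v ^ 6 / 6 + v ^ 8 / 24 - v ^ 10 / 100) ≤
      ∫ v in (0 : ℝ)..z, Real.exp (-v ^ 2) := by
    apply intervalIntegral.integral_mono_on hz
      (Continuous.intervalIntegrable (by fun_prop) _ _) (cont_gauss.intervalIntegrable _ _)
    intro v hv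
    have := abs_le.1 (gauss_approx hv.1 (hv.2.trans hz1))
    linarith
  refine le_trans (le_of_eq ?_) h
  rw [intervalIntegral.integral_eq_sub_of_hasDerivAt (f := fun z : ℝ =>
    z - z ^ 3 / 3 + z ^ 5 / 10 - z ^ 7 / 42 + z ^ 9 / 216 - z ^ 11 / 1100) ?_
    (Continuous.intervalIntegrable (by fun_prop) _ _)]
  · norm_num
  · intro v _
    refine HasDerivAt.congr_deriv ((((((hasDerivAt_id v).sub ((hasDerivAt_pow 3 v).div_const 3)).add
      ((hasDerivAt_pow 5 v).div_const 10)).sub ((hasDerivAt_pow 7 v).div_const 42)).add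
      ((hasDerivAt_pow 9 v).div_const 216)).sub ((hasDerivAt_pow 11 v).div_const 1100)) ?_
    norm_num
    ring

lemma sqrtpi_lower : 1.77245 < Real.sqrt π := by
  apply Real.lt_sqrt_of_sq_lt
  have := Real.pi_gt_d6
  norm_num at this ⊢; linarith

lemma sqrtpi_upper : Real.sqrt π < 1.77246 := by
  rw [Real.sqrt_lt' (by norm_num)]
  have := Real.pi_lt_d6
  norm_num at this ⊢; linarith

lemma exp_form (z : ℝ) : Real.exp (z ^ 2) * Real.exp (-z ^ 2) = 1 := by
  rw [← Real.exp_add]; simp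

lemma GG_hi : GG 0.433 < 1 / 2 := by
  have h1 := II_lower (z := 0.433) (by norm_num) (by norm_num)
  have h2 := II_eq 0.433
  have h3 := (abs_le.1 (gauss_approx (v := 0.433) (by norm_num) (by norm_num))).2
  have h4 := sqrtpi_lower
  have h5 := exp_form 0.433
  have h6 := Real.exp_pos (0.433 ^ 2)
  have h7 : Real.exp (-0.433 ^ 2) < 4 * 0.433 * II 0.433 := by
    rw [h2]
    norm_num at h1 h3 h4 ⊢
    linarith
  unfold GG
  have := mul_lt_mul_of_pos_left h7 h6
  rw [h5] at this
  linarith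

lemma GG_lo : 1 / 2 < GG 0.4325 := by
  have h1 := II_upper (z := 0.4325) (by norm_num) (by norm_num)
  have h2 := II_eq 0.4325
  have h3 := (abs_le.1 (gauss_approx (v := 0.4325) (by norm_num) (by norm_num))).1
  have h4 := sqrtpi_upper
  have h5 := exp_form 0.4325
  have h6 := Real.exp_pos (0.4325 ^ 2)
  have h7 : 4 * 0.4325 * II 0.4325 < Real.exp (-0.4325 ^ 2) := by
    rw [h2]
    norm_num at h1 h3 h4 ⊢
    linarith
  unfold GG
  have := mul_lt_mul_of_pos_left h7 h6
  rw [h5] at this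
  linarith

lemma approx (C : ℝ) (hC : 0 < C) (h : limitExpr C = 1 / 2) : |C - 1.634| < 0.001 := by
  rw [limitExpr_eq hC] at h
  have h2p : 0 < Real.sqrt 2 := by positivity
  have hs1 : 1.41421 < Real.sqrt 2 := Real.lt_sqrt_of_sq_lt (by norm_num)
  have hs2 : Real.sqrt 2 < 1.41422 := by rw [Real.sqrt_lt' (by norm_num)]; norm_num
  set z := 1 / (Real.sqrt 2 * C) with hz
  have hzp : 0 < z := by positivity
  have hzC : z * (Real.sqrt 2 * C) = 1 := by rw [hz]; field_simp
  have l1 : 0.4325 < z := by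
    by_contra hc
    rcases (not_lt.1 hc).lt_or_eq with hc | hc
    · have := GG_anti hzp hc
      linarith [GG_lo]
    · rw [hc] at h; linarith [GG_lo]
  have l2 : z < 0.433 := by
    by_contra hc
    rcases (not_lt.1 hc).lt_or_eq with hc | hc
    · have := GG_anti (by norm_num) hc
      linarith [GG_hi]
    · rw [← hc] at h; linarith [GG_hi]
  have m1 : 0.4325 * 1.41421 < z * Real.sqrt 2 := by gcongr
  have m2 : z * Real.sqrt 2 < 0.433 * 1.41422 := by gcongr
  rw [← mul_assoc] at hzC
  have n1 := mul_lt_mul_of_pos_right m1 hC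
  have n2 := mul_lt_mul_of_pos_right m2 hC
  rw [hzC] at n1 n2
  rw [abs_lt]
  norm_num at n1 n2 ⊢
  constructor <;> linarith

lemma exists_sol : ∃ C : ℝ, 0 < C ∧ limitExpr C = 1 / 2 := by
  have := intermediate_value_Icc' (a := (0.4325 : ℝ)) (b := 0.433) (by norm_num)
    GG_cont.continuousOn
  obtain ⟨z, hz, h⟩ := this ⟨GG_hi.le, GG_lo.le⟩
  have hzp : 0 < z := lt_of_lt_of_le (by norm_num) hz.1
  have h2p : 0 < Real.sqrt 2 := by positivity
  have hC : 0 < 1 / (Real.sqrt 2 * z) := by positivity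
  refine ⟨_, hC, ?_⟩
  rw [limitExpr_eq hC, ← h]
  congr 1
  field_simp

lemma tau_eq {C : ℝ} (hC : 0 < C) {p : ℕ} (hp : 1 ≤ p) : tau (C * Real.sqrt p) p =
    ∫ u in Set.Ioi (0 : ℝ), 1 / 2 * ((1 + u) ^ (-(3 : ℝ) / 2) *
      (1 + u / C ^ 2 / p) ^ ((1 - (p : ℝ)) / 2)) := by
  have hp0 : (0 : ℝ) < p := by exact_mod_cast hp
  have hl : (C * Real.sqrt p) ^ 2 = C ^ 2 * p := by rw [mul_pow, Real.sq_sqrt hp0.le]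
  have hb : 0 < C ^ 2 * p := by positivity
  unfold tau
  rw [hl, integral_const_mul]
  have h := integral_comp_mul_left_Ioi (fun u : ℝ => (1 + u) ^ (-(3 : ℝ) / 2) *
      (1 + u / C ^ 2 / p) ^ ((1 - (p : ℝ)) / 2)) 0 hb
  simp only [mul_zero, smul_eq_mul] at h
  have e : ∀ x : ℝ, C ^ 2 * p * x / C ^ 2 / p = x := fun x => by field_simp
  simp only [e] at h
  rw [h]
  field_simp

lemma pt_lim (t : ℝ) (ht : 0 < t) : Tendsto (fun p : ℕ => (1 + t / p) ^ ((1 - (p : ℝ)) / 2)) atTop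
    (nhds (Real.exp (-t / 2))) := by
  have h0 : Tendsto (fun p : ℕ => 1 + t / (p : ℝ)) atTop (nhds 1) := by
    simpa using (tendsto_const_div_atTop_nhds_zero_nat t).const_add 1
  have h1 := h0.rpow_const (p := 1 / 2) (Or.inl one_ne_zero)
  have h2 := (Real.tendsto_one_add_div_pow_exp t).rpow_const (p := -1 / 2)
    (Or.inl (Real.exp_pos t).ne')
  have h3 := h1.mul h2
  rw [Real.one_rpow, one_mul, ← Real.exp_mul] at h3
  rw [show -t / 2 = t * (-1 / 2) by ring]
  refine h3.congr fun p => ?_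
  have hp : 0 < 1 + t / (p : ℝ) := by positivity
  rw [← Real.rpow_natCast, ← Real.rpow_mul hp.le, ← Real.rpow_add hp]
  congr 1
  ring

lemma tau_lim (C : ℝ) (hC : 0 < C) :
    Tendsto (fun p : ℕ => tau (C * Real.sqrt p) p) atTop (nhds (limitExpr C)) := by
  have hz : 0 < 1 / (Real.sqrt 2 * C) := by positivity
  rw [limitExpr_eq hC, ← GG_eq hz]
  have ev : ∀ᶠ p : ℕ in atTop, 1 ≤ p := eventually_ge_atTop 1
  refine Tendsto.congr' (ev.mono fun p hp => (tau_eq hC hp).symm) ?_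
  apply tendsto_integral_filter_of_dominated_convergence
    (fun u : ℝ => (u + 1) ^ (-(3 : ℝ) / 2))
  · refine Eventually.of_forall fun p => ?_
    exact Measurable.aestronglyMeasurable (by fun_prop)
  · filter_upwards [ev] with p hp
    filter_upwards [ae_restrict_mem measurableSet_Ioi] with u hu
    have hu : 0 < u := hu
    have hp1 : (1 : ℝ) ≤ p := by exact_mod_cast hp
    have a1 : 0 < (1 + u) ^ (-(3 : ℝ) / 2) := Real.rpow_pos_of_pos (by linarith) _
    have hb : 1 ≤ 1 + u / C ^ 2 / p := by
      have : 0 ≤ u / C ^ 2 / p := by positivity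
      linarith
    have a2 : 0 < (1 + u / C ^ 2 / p) ^ ((1 - (p : ℝ)) / 2) :=
      Real.rpow_pos_of_pos (by linarith) _
    have a3 : (1 + u / C ^ 2 / p) ^ ((1 - (p : ℝ)) / 2) ≤ 1 :=
      Real.rpow_le_one_of_one_le_of_nonpos hb (by linarith)
    rw [Real.norm_of_nonneg (by positivity), add_comm u 1]
    nlinarith
  · exact integrableOn_add_rpow_Ioi_of_lt (by norm_num) (by norm_num)
  · filter_upwards [ae_restrict_mem measurableSet_Ioi] with u hu
    have hu : 0 < u := hu
    have h := pt_lim (u / C ^ 2) (by positivity)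
    have e : -(u / C ^ 2) / 2 = -u * (1 / (Real.sqrt 2 * C)) ^ 2 := by
      rw [div_pow, mul_pow, Real.sq_sqrt (by norm_num)]
      field_simp
    rw [e] at h
    exact (h.const_mul _).const_mul _

/-- τ(C√p, p) → 1 − √(π/2)(e^{1/(2C²)}/C)erfc(1/(√2C)) as p → ∞; the
limiting expression is strictly increasing in C > 0, and the equation = 1/2 has a
unique positive solution C ≈ 1.634. -/
theorem tau_sqrt_p_limit :
    (∀ C : ℝ, 0 < C →
      Tendsto (fun p : ℕ => tau (C * Real.sqrt p) p) atTop (nhds (limitExpr C))) ∧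
    StrictMonoOn limitExpr (Set.Ioi 0) ∧
    (∃! C : ℝ, 0 < C ∧ limitExpr C = 1 / 2) ∧
    (∀ C : ℝ, 0 < C → limitExpr C = 1 / 2 → |C - 1.634| < 0.001) := by
  refine ⟨tau_lim, strictMono, ?_, approx⟩
  obtain ⟨C, hC, h⟩ := exists_sol
  refine ⟨C, ⟨hC, h⟩, ?_⟩
  rintro D ⟨hD, h'⟩
  exact strictMono.injOn hD hC (h'.trans h.symm)
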